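/- For β ∈ ℝ define τU_β := ⊕_{k∈ℤ} τ^k ⊗ (V_{β+k} ∩ M) ⊆ τM, and define the ℂ-linear operator Θ : τM → τM by Θ(τ^k ⊗ m) := τ^{k+1} ⊗ (z·∇(m) + k·z·m) (the action of τ·ð_τ, ð_τ = z∂_τ, on the rescaled module; note z·∇(m) ∈ M). Then (τU_β)_{β∈ℝ} is the V-filtration of τM along τ = 0, namely: (a) τU_β ⊆ τU_γ for β ≤ γ, ⋃_β τU_β = τM, τ·τU_β = τU_{β−1}, and z·τU_β ⊆ τU_β; (b) each τU_β is finitely generated as a module over the subring ℂ[τ,z] ⊆ ℂ[τ,τ⁻¹,z]; (c) τU_β = τU_γ whenever β ≤ γ and (β,γ] contains no element of A+ℤ; (d) (Θ + β·z)^ν(τU_β) ⊆ τU_{<β} := ⋃_{γ<β} τU_γ for every β; (e) for every β, the quotient τU_β/τU_{<β} is a torsion-free module over the polynomial subring ℂ[z]. (Core of the proof of Proposition 2.4.2 of 'Irregular Hodge theory': τM is strictly ℝ-specializable and regular along τ = 0.) -/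

import Mathlib

noncomputable section

open Submodule Set

variable {N : Type*} [AddCommGroup N] [Module ℂ N]

/-- `M` is (the image of) a finite free `ℂ[z]`-module of rank `r` inside
`N = ℂ[z,z⁻¹] ⊗_{ℂ[z]} M`, where multiplication by `z` is the automorphism `z` of `N`.
This is encoded by `z`-stability of `M` together with the existence of an `r`-element
family `b` of elements of `M` such that `(z^k (b i))` for `k ∈ ℤ` is a `ℂ`-basis of `N`
and `(z^k (b i))` for `k ∈ ℕ` is a `ℂ`-basis of `M`. -/
def IsFreeLattice (z : N ≃ₗ[ℂ] N) (M : Submodule ℂ N) (r : ℕ) : Prop :=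
  (∀ x ∈ M, z x ∈ M) ∧
  ∃ b : Fin r → N,
    LinearIndependent ℂ (fun p : Fin r × ℤ => (z ^ p.2) (b p.1)) ∧
    Submodule.span ℂ (Set.range fun p : Fin r × ℤ => (z ^ p.2) (b p.1)) = ⊤ ∧
    Submodule.span ℂ (Set.range fun p : Fin r × ℕ => (z ^ (p.2 : ℤ)) (b p.1)) = M

/-- A V-lattice filtration on `N` (with jumps in `A + ℤ`, `A ⊆ [0,1)` finite):
(i) increasing; (ii) `z · V_β = V_{β+1}`; (iii) each `V_β` is stable under `z⁻¹` and
finitely generated over `ℂ[z⁻¹]`; (iv) the `ℂ[z,z⁻¹]`-span of each `V_β` is `N`;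
(v) `V_β = V_γ` if `(β,γ] ∩ (A + ℤ) = ∅`. -/
structure IsVLattice (z : N ≃ₗ[ℂ] N) (V : ℝ → Submodule ℂ N) (A : Finset ℝ) : Prop where
  mono : Monotone V
  map_z : ∀ β : ℝ, (V β).map z.toLinearMap = V (β + 1)
  zinv_stable : ∀ β : ℝ, ∀ x ∈ V β, z.symm x ∈ V β
  fg_zinv : ∀ β : ℝ, ∃ S : Finset N, (S : Set N) ⊆ (V β : Set N) ∧
    V β = Submodule.span ℂ {x : N | ∃ k : ℕ, ∃ s ∈ S, x = (z.symm ^ k) s}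
  span_laurent : ∀ β : ℝ, Submodule.span ℂ {x : N | ∃ k : ℤ, ∃ v ∈ V β, x = (z ^ k) v} = ⊤
  jumpsIn : ∀ a ∈ A, (0 : ℝ) ≤ a ∧ a < 1
  jumps : ∀ β γ : ℝ, β ≤ γ →
    (∀ a ∈ A, ∀ k : ℤ, ¬ (β < a + k ∧ a + k ≤ γ)) → V β = V γ

/-- `V_{<β} := ⋃_{γ < β} V_γ`. -/
def Vlt (V : ℝ → Submodule ℂ N) (β : ℝ) : Submodule ℂ N := ⨆ γ ∈ Set.Iio β, V γ

/-- The Harder–Narasimhan filtration of `N`: `F^HN_β(N)` is the `ℂ[z,z⁻¹]`-span of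
`V_β ∩ M`. -/
def FHN (z : N ≃ₗ[ℂ] N) (V : ℝ → Submodule ℂ N) (M : Submodule ℂ N) (β : ℝ) :
    Submodule ℂ N :=
  Submodule.span ℂ {x : N | ∃ k : ℤ, ∃ v ∈ V β ⊓ M, x = (z ^ k) v}


/-- The submodule of `ℤ →₀ P` of elements with `k`-th component in `W k`; this is the
internal direct sum `⊕_{k∈ℤ} τ^k ⊗ W k` inside `τP = ℂ[τ,τ⁻¹] ⊗_ℂ P = ℤ →₀ P`. -/
def finsuppPi {P : Type*} [AddCommGroup P] [Module ℂ P] (W : ℤ → Submodule ℂ P) :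
    Submodule ℂ (ℤ →₀ P) where
  carrier := {f | ∀ k : ℤ, f k ∈ W k}
  add_mem' := by
    intro f g hf hg k
    rw [Finsupp.add_apply]; exact add_mem (hf k) (hg k)
  zero_mem' := by intro k; rw [Finsupp.zero_apply]; exact zero_mem _
  smul_mem' := by
    intro c f hf k
    rw [Finsupp.smul_apply]; exact Submodule.smul_mem _ c (hf k)

/-- The action of `τ` on the rescaled module `τN = ℤ →₀ N` (shift of indices). -/
def Tsh (P : Type*) [AddCommGroup P] [Module ℂ P] : (ℤ →₀ P) ≃ₗ[ℂ] (ℤ →₀ P) :=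
  Finsupp.domLCongr (Equiv.addRight (1 : ℤ))

/-- The action of `z` on the rescaled module: `z·(τ^k ⊗ m) = τ^{k+1} ⊗ (z·m)`. -/
def Zop (z : N ≃ₗ[ℂ] N) : (ℤ →₀ N) →ₗ[ℂ] (ℤ →₀ N) :=
  (Tsh N).toLinearMap ∘ₗ Finsupp.mapRange.linearMap z.toLinearMap

/-- The action of `τ·ð_τ` (`ð_τ = z∂_τ`) on the rescaled module:
`Θ(τ^k ⊗ m) = τ^{k+1} ⊗ (z·∇(m) + k·z·m)`. -/
def Theta (z : N ≃ₗ[ℂ] N) (nab : N →ₗ[ℂ] N) : (ℤ →₀ N) →ₗ[ℂ] (ℤ →₀ N) :=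
  Finsupp.lsum ℂ fun k : ℤ =>
    (Finsupp.lsingle (k + 1)) ∘ₗ (z.toLinearMap ∘ₗ nab + (k : ℂ) • z.toLinearMap)

/-- `τU_β := ⊕_{k∈ℤ} τ^k ⊗ (V_{β+k} ∩ M) ⊆ τM`. -/
def tauU (V : ℝ → Submodule ℂ N) (M : Submodule ℂ N) (β : ℝ) : Submodule ℂ (ℤ →₀ N) :=
  finsuppPi fun k : ℤ => V (β + k) ⊓ M

section Helpers

variable {P : Type*} [AddCommGroup P] [Module ℂ P]

lemma mem_finsuppPi {W : ℤ → Submodule ℂ P} {f : ℤ →₀ P} :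
    f ∈ finsuppPi W ↔ ∀ k, f k ∈ W k := Iff.rfl

lemma single_mem_finsuppPi {W : ℤ → Submodule ℂ P} {k : ℤ} {x : P} (hx : x ∈ W k) :
    Finsupp.single k x ∈ finsuppPi W := by
  intro l
  by_cases h : k = l
  · subst h; simpa using hx
  · simp [Finsupp.single_eq_of_ne' h]

/-- An element of `ℤ →₀ P` lies in a submodule as soon as its homogeneous components do. -/
lemma mem_of_single_mem (T : Submodule ℂ (ℤ →₀ P)) (f : ℤ →₀ P)
    (h : ∀ k, Finsupp.single k (f k) ∈ T) : f ∈ T := by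
  rw [← Finsupp.sum_single f]
  exact Submodule.sum_mem _ fun k _ => h k

lemma Tsh_single (k : ℤ) (x : P) :
    Tsh P (Finsupp.single k x) = Finsupp.single (k + 1) x := by
  simp [Tsh]

lemma Tsh_apply (f : ℤ →₀ P) (k : ℤ) : Tsh P f k = f (k - 1) := by
  simp [Tsh, sub_eq_add_neg]

lemma Zop_apply (z : N ≃ₗ[ℂ] N) (f : ℤ →₀ N) (k : ℤ) : Zop z f k = z (f (k - 1)) := by
  simp [Zop, Tsh_apply]

lemma Zop_single (z : N ≃ₗ[ℂ] N) (k : ℤ) (x : N) :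
    Zop z (Finsupp.single k x) = Finsupp.single (k + 1) (z x) := by
  simp [Zop, Tsh_single]

lemma Zop_pow_apply (z : N ≃ₗ[ℂ] N) (n : ℕ) (f : ℤ →₀ N) (k : ℤ) :
    (Zop z ^ n) f k = (z ^ n) (f (k - n)) := by
  induction n generalizing k with
  | zero => simp
  | succ n ih =>
    rw [pow_succ', pow_succ', Module.End.mul_apply, Zop_apply, ih, LinearEquiv.mul_apply]
    rw [show k - 1 - n = k - ((n + 1 : ℕ) : ℤ) by push_cast; ring]

lemma Tsh_Zop_comm (z : N ≃ₗ[ℂ] N) (f : ℤ →₀ N) :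
    Tsh N (Zop z f) = Zop z (Tsh N f) := by
  ext k; simp only [Tsh_apply, Zop_apply]

lemma Zop_Tsh_pow (z : N ≃ₗ[ℂ] N) (a : ℕ) (f : ℤ →₀ N) :
    Zop z ((Tsh N ^ a) f) = (Tsh N ^ a) (Zop z f) := by
  induction a with
  | zero => simp
  | succ a ih => rw [pow_succ', LinearEquiv.mul_apply, LinearEquiv.mul_apply, ← Tsh_Zop_comm, ih]

lemma mem_Vlt {V : ℝ → Submodule ℂ P} (hV : Monotone V) {β : ℝ} {x : P} :
    x ∈ Vlt V β ↔ ∃ γ < β, x ∈ V γ := by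
  have : Nonempty (Set.Iio β) := ⟨β - 1, by simp⟩
  rw [Vlt, iSup_subtype', Submodule.mem_iSup_of_directed]
  · simp
  · exact Monotone.directed_le fun a b h => hV h

variable {z : N ≃ₗ[ℂ] N} {V : ℝ → Submodule ℂ N} {A : Finset ℝ} {M : Submodule ℂ N} {r : ℕ}

namespace IsVLattice

lemma z_mem_iff (hV : IsVLattice z V A) {β : ℝ} {x : N} : z x ∈ V (β + 1) ↔ x ∈ V β := by
  rw [← hV.map_z]
  simp

lemma pow_mem_iff (hV : IsVLattice z V A) (n : ℕ) {β : ℝ} {x : N} :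
    (z ^ n) x ∈ V (β + n) ↔ x ∈ V β := by
  induction n with
  | zero => simp
  | succ n ih =>
    rw [pow_succ', LinearEquiv.mul_apply, Nat.cast_succ, ← add_assoc, hV.z_mem_iff, ih]

lemma zpow_mem_iff (hV : IsVLattice z V A) (k : ℤ) {β : ℝ} {x : N} :
    (z ^ k) x ∈ V (β + k) ↔ x ∈ V β := by
  obtain ⟨n, rfl | rfl⟩ := k.eq_nat_or_neg
  · simpa using hV.pow_mem_iff n
  · rw [← hV.pow_mem_iff n, ← LinearEquiv.mul_apply, zpow_neg, zpow_natCast, mul_inv_cancel]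
    simp

lemma zinv_zpow_mem (hV : IsVLattice z V A) {β : ℝ} {x : N} (hx : x ∈ V β) {k : ℤ}
    (hk : k ≤ 0) : (z ^ k) x ∈ V β := by
  have h := (hV.zpow_mem_iff k).2 hx
  have hk' : (k : ℝ) ≤ 0 := by exact_mod_cast hk
  exact hV.mono (by linarith) h

lemma pow_mem_Vlt_iff (hV : IsVLattice z V A) (n : ℕ) {β : ℝ} {x : N} :
    (z ^ n) x ∈ Vlt V (β + n) ↔ x ∈ Vlt V β := by
  simp only [mem_Vlt hV.mono]
  constructor
  · rintro ⟨γ, hγ, h⟩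
    refine ⟨γ - n, by linarith, ?_⟩
    rwa [← hV.pow_mem_iff n, sub_add_cancel]
  · rintro ⟨γ, hγ, h⟩
    exact ⟨γ + n, by linarith, (hV.pow_mem_iff n).2 h⟩

/-- The filtration `V` exhausts `N`. -/
lemma exists_mem (hV : IsVLattice z V A) (x : N) : ∃ β, x ∈ V β := by
  have hx : x ∈ (⊤ : Submodule ℂ N) := Submodule.mem_top
  rw [← hV.span_laurent 0] at hx
  induction hx using Submodule.span_induction with
  | mem x h =>
    obtain ⟨k, v, hv, rfl⟩ := h
    exact ⟨_, (hV.zpow_mem_iff k).2 hv⟩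
  | zero => exact ⟨0, zero_mem _⟩
  | add x y _ _ hx hy =>
    obtain ⟨β, hx⟩ := hx
    obtain ⟨γ, hy⟩ := hy
    exact ⟨max β γ, add_mem (hV.mono (le_max_left _ _) hx) (hV.mono (le_max_right _ _) hy)⟩
  | smul c x _ hx =>
    obtain ⟨β, hx⟩ := hx
    exact ⟨β, Submodule.smul_mem _ _ hx⟩

/-- Finitely many elements of `N` lie in a common step of the filtration. -/
lemma exists_forall_mem (hV : IsVLattice z V A) {ι : Type*} (s : Finset ι) (x : ι → N)
    (c : ι → ℝ) : ∃ β, ∀ i ∈ s, x i ∈ V (β + c i) := by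
  choose g hg using fun i => hV.exists_mem (x i)
  obtain ⟨β, hβ⟩ := (s.image fun i => g i - c i).bddAbove
  refine ⟨β, fun i hi => hV.mono ?_ (hg i)⟩
  have := hβ (Finset.mem_coe.2 (Finset.mem_image_of_mem _ hi))
  linarith

/-- `V_α + M = N` for large `α`. -/
lemma exists_sup_eq_top (hV : IsVLattice z V A) (hM : IsFreeLattice z M r) :
    ∃ α₀, ∀ α, α₀ ≤ α → V α ⊔ M = ⊤ := by
  obtain ⟨-, b, -, hN, hM⟩ := hM
  obtain ⟨α₀, hα₀⟩ := hV.exists_forall_mem Finset.univ b 0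
  refine ⟨α₀, fun α hα => ?_⟩
  rw [eq_top_iff, ← hN, Submodule.span_le]
  rintro _ ⟨⟨i, k⟩, rfl⟩
  obtain hk | hk := le_total k 0
  · refine Submodule.mem_sup_left (hV.zinv_zpow_mem (hV.mono hα ?_) hk)
    simpa using hα₀ i (Finset.mem_univ i)
  · refine Submodule.mem_sup_right ?_
    rw [← hM]
    exact Submodule.subset_span ⟨(i, k.toNat), by simp [Int.toNat_of_nonneg hk]⟩

/-- `V_{α+1} ∩ M = (V_α ∩ M) + z (V_α ∩ M)` as soon as `V_{α-1} + M = N`. -/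
lemma exists_eq_add_z (hV : IsVLattice z V A) (hM : IsFreeLattice z M r) {α : ℝ}
    (hα : V (α - 1) ⊔ M = ⊤) {x : N} (hx : x ∈ V (α + 1) ⊓ M) :
    ∃ y ∈ V α ⊓ M, ∃ w ∈ V α ⊓ M, x = y + z w := by
  have h : z.symm x ∈ V (α - 1) ⊔ M := hα ▸ Submodule.mem_top
  obtain ⟨v, hv, w, hw, hvw⟩ := Submodule.mem_sup.1 h
  have hxα : z.symm x ∈ V α := by
    rw [← hV.z_mem_iff, LinearEquiv.apply_symm_apply]; exact hx.1
  have hx' : x = z v + z w := by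
    rw [← map_add, hvw, LinearEquiv.apply_symm_apply]
  have hzv : z v ∈ V α := by simpa using hV.z_mem_iff.2 hv
  have hwα : w ∈ V α := by
    rw [← eq_sub_iff_add_eq'] at hvw
    rw [hvw]
    exact sub_mem hxα (hV.mono (by linarith) hv)
  refine ⟨z v, ⟨hzv, ?_⟩, w, ⟨hwα, hw⟩, hx'⟩
  rw [← sub_eq_iff_eq_add] at hx'
  rw [← hx']
  exact sub_mem hx.2 (hM.1 _ hw)

/-- In terms of the `ℂ`-basis `z^k b_i` of `N`, the lattice `M` is spanned by the terms with
`k ≥ 0`, and each `V_α` lies in the span of the terms with `k` bounded above, uniformly up to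
shifts. -/
lemma exists_basis (hV : IsVLattice z V A) (hM : IsFreeLattice z M r) :
    ∃ c : Module.Basis (Fin r × ℤ) ℂ N, M = span ℂ (c '' {p | 0 ≤ p.2}) ∧
      ∀ α : ℝ, ∃ K : ℤ, ∀ n : ℤ, V (α + n) ≤ span ℂ (c '' {p | p.2 ≤ K + n}) := by
  obtain ⟨-, b, hli, hN, hM⟩ := hM
  let c := Module.Basis.mk hli hN.ge
  have hc (p : Fin r × ℤ) : c p = (z ^ p.2) (b p.1) := Module.Basis.mk_apply hli hN.ge p
  have hshift (K n : ℤ) (x : N) (hx : x ∈ span ℂ (c '' {p | p.2 ≤ K})) :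
      (z ^ n) x ∈ span ℂ (c '' {p | p.2 ≤ K + n}) := by
    induction hx using Submodule.span_induction with
    | mem x h =>
      obtain ⟨p, hp, rfl⟩ := h
      refine Submodule.subset_span ⟨(p.1, p.2 + n), by simpa using hp, ?_⟩
      rw [hc, hc, ← LinearEquiv.mul_apply, ← zpow_add, add_comm]
    | zero => simp
    | add x y _ _ hx hy => rw [map_add]; exact add_mem hx hy
    | smul a x _ hx => rw [map_smul]; exact Submodule.smul_mem _ _ hx
  have hmono {K L : ℤ} (h : K ≤ L) :
      span ℂ (c '' {p | p.2 ≤ K}) ≤ span ℂ (c '' {p | p.2 ≤ L}) :=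
    Submodule.span_mono (Set.image_mono fun p (hp : p.2 ≤ K) => hp.trans h)
  refine ⟨c, ?_, fun α => ?_⟩
  · rw [← hM]
    congr 1
    ext x
    constructor
    · rintro ⟨⟨i, k⟩, rfl⟩
      exact ⟨(i, k), by simp, hc _⟩
    · rintro ⟨⟨i, k⟩, hk, rfl⟩
      exact ⟨(i, k.toNat), by simp [hc, Int.toNat_of_nonneg (show 0 ≤ k from hk)]⟩
  · obtain ⟨S, -, hS⟩ := hV.fg_zinv α
    obtain ⟨K, hK⟩ := ((S.biUnion fun s => (c.repr s).support).image Prod.snd).bddAbove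
    have hSK : ∀ s ∈ S, s ∈ span ℂ (c '' {p | p.2 ≤ K}) := by
      intro s hs
      rw [Module.Basis.mem_span_image]
      intro p hp
      refine hK (Finset.mem_coe.2 (Finset.mem_image_of_mem _ (Finset.mem_biUnion.2 ⟨s, hs, hp⟩)))
    have hαK : V α ≤ span ℂ (c '' {p | p.2 ≤ K}) := by
      rw [hS, Submodule.span_le]
      rintro _ ⟨k, s, hs, rfl⟩
      have h := hmono (show K + -k ≤ K by lia) (hshift K (-k) s (hSK s hs))
      rwa [zpow_neg, zpow_natCast, ← inv_pow] at h
    refine ⟨K, fun n x hx => ?_⟩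
    have h : (z ^ (-n)) x ∈ V α := by
      have := (hV.zpow_mem_iff (-n)).2 hx
      simpa using this
    have := hshift K n _ (hαK h)
    rwa [← LinearEquiv.mul_apply, ← zpow_add, add_neg_cancel, zpow_zero] at this

/-- `V_α ∩ M` is finite-dimensional. -/
lemma fg_inf (hV : IsVLattice z V A) (hM : IsFreeLattice z M r) (α : ℝ) : (V α ⊓ M).FG := by
  obtain ⟨c, hMc, hVc⟩ := hV.exists_basis hM
  obtain ⟨K, hK⟩ := hVc α
  have hfin : (c '' {p : Fin r × ℤ | p.2 ∈ Set.Icc 0 K}).Finite := by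
    refine Set.Finite.image _ (((Set.finite_univ (α := Fin r)).prod (Set.finite_Icc 0 K)).subset ?_)
    intro p hp
    exact ⟨Set.mem_univ _, hp⟩
  have : FiniteDimensional ℂ (span ℂ (c '' {p : Fin r × ℤ | p.2 ∈ Set.Icc 0 K})) :=
    FiniteDimensional.span_of_finite ℂ hfin
  have hle : V α ⊓ M ≤ span ℂ (c '' {p : Fin r × ℤ | p.2 ∈ Set.Icc 0 K}) := by
    rintro x ⟨hxV, hxM⟩
    have h1 := hK 0 (by simpa using hxV)
    rw [SetLike.mem_coe, hMc] at hxM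
    rw [Module.Basis.mem_span_image] at h1 hxM ⊢
    intro p hp
    exact ⟨hxM hp, by simpa using h1 hp⟩
  have := Submodule.finiteDimensional_of_le hle
  exact Module.Finite.iff_fg.1 this

/-- `V_{α+n} ∩ M = 0` for integers `n ≪ 0`. -/
lemma exists_inf_eq_bot (hV : IsVLattice z V A) (hM : IsFreeLattice z M r) (α : ℝ) :
    ∃ n₀ : ℤ, ∀ n : ℤ, n ≤ n₀ → V (α + n) ⊓ M = ⊥ := by
  obtain ⟨c, hMc, hVc⟩ := hV.exists_basis hM
  obtain ⟨K, hK⟩ := hVc α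
  refine ⟨-K - 1, fun n hn => ?_⟩
  rw [eq_bot_iff]
  rintro x ⟨hxV, hxM⟩
  have h1 := hK n hxV
  rw [SetLike.mem_coe, hMc] at hxM
  rw [Module.Basis.mem_span_image] at h1 hxM
  rw [Submodule.mem_bot, ← c.repr.map_eq_zero_iff, ← Finsupp.support_eq_empty,
    Finset.eq_empty_iff_forall_notMem]
  intro p hp
  have h2 : p.2 ≤ K + n := h1 hp
  have h3 : 0 ≤ p.2 := hxM hp
  lia

lemma monotone_tauU (hV : IsVLattice z V A) : Monotone (tauU V M) := by
  intro β γ h f hf k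
  exact ⟨hV.mono (by linarith) (hf k).1, (hf k).2⟩

lemma mem_Vlt_tauU (hV : IsVLattice z V A) {β : ℝ} {f : ℤ →₀ N} :
    f ∈ Vlt (tauU V M) β ↔ ∀ k : ℤ, f k ∈ Vlt V (β + k) ⊓ M := by
  constructor
  · intro h k
    obtain ⟨γ, hγ, hf⟩ := (mem_Vlt hV.monotone_tauU).1 h
    exact ⟨(mem_Vlt hV.mono).2 ⟨γ + k, by linarith, (hf k).1⟩, (hf k).2⟩
  · intro h
    refine mem_of_single_mem _ _ fun k => ?_
    obtain ⟨γ, hγ, hk⟩ := (mem_Vlt hV.mono).1 (h k).1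
    refine (mem_Vlt hV.monotone_tauU).2 ⟨γ - k, by linarith, single_mem_finsuppPi ⟨?_, (h k).2⟩⟩
    rwa [sub_add_cancel]

lemma iSup_tauU (hV : IsVLattice z V A) :
    (⨆ β : ℝ, tauU V M β) = finsuppPi (fun _ : ℤ => M) := by
  refine le_antisymm (iSup_le fun β f hf k => (hf k).2) fun f hf => ?_
  obtain ⟨β, hβ⟩ := hV.exists_forall_mem f.support f (fun k => (k : ℝ))
  refine Submodule.mem_iSup_of_mem β fun k => ⟨?_, hf k⟩
  by_cases hk : k ∈ f.support
  · exact hβ k hk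
  · rw [Finsupp.notMem_support_iff.1 hk]; exact zero_mem _

lemma Tsh_mem_tauU_iff {β : ℝ} {f : ℤ →₀ N} :
    Tsh N f ∈ tauU V M (β - 1) ↔ f ∈ tauU V M β := by
  simp only [tauU, mem_finsuppPi, Tsh_apply]
  constructor
  · intro h k
    convert h (k + 1) using 2
    · push_cast; congr 1; ring
    · simp
  · intro h k
    convert h (k - 1) using 3
    push_cast; ring

lemma Zop_mem_tauU (hV : IsVLattice z V A) (hM : IsFreeLattice z M r) {β : ℝ} {f : ℤ →₀ N}
    (hf : f ∈ tauU V M β) : Zop z f ∈ tauU V M β := by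
  intro k
  rw [Zop_apply]
  refine ⟨?_, hM.1 _ (hf _).2⟩
  have := hV.z_mem_iff.2 (hf (k - 1)).1
  rwa [show β + ((k - 1 : ℤ) : ℝ) + 1 = β + k by push_cast; ring] at this

lemma Tsh_mem_tauU (hV : IsVLattice z V A) {β : ℝ} {f : ℤ →₀ N}
    (hf : f ∈ tauU V M β) : Tsh N f ∈ tauU V M β :=
  hV.monotone_tauU (by linarith) (Tsh_mem_tauU_iff.2 hf)

lemma fg_tauU (hV : IsVLattice z V A) (hM : IsFreeLattice z M r) (β : ℝ) :
    ∃ S : Finset (ℤ →₀ N), (S : Set (ℤ →₀ N)) ⊆ tauU V M β ∧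
      tauU V M β = Submodule.span ℂ
        {x : ℤ →₀ N | ∃ a b : ℕ, ∃ s ∈ S, x = ((Tsh N) ^ a) (((Zop z) ^ b) s)} := by
  classical
  choose G hG using fun k : ℤ => hV.fg_inf hM (β + k)
  obtain ⟨n₀, hn₀⟩ := hV.exists_inf_eq_bot hM β
  obtain ⟨α₀, hα₀⟩ := hV.exists_sup_eq_top hM
  obtain ⟨n₁, hn₁⟩ := exists_int_gt (α₀ - β + 1)
  let S : Finset (ℤ →₀ N) := (Finset.Icc n₀ n₁).biUnion fun k => (G k).image (Finsupp.single k)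
  have hSU : (S : Set (ℤ →₀ N)) ⊆ tauU V M β := by
    intro f hf
    obtain ⟨k, -, hk⟩ := Finset.mem_biUnion.1 (Finset.mem_coe.1 hf)
    obtain ⟨x, hx, rfl⟩ := Finset.mem_image.1 hk
    exact single_mem_finsuppPi (W := fun k : ℤ => V (β + k) ⊓ M)
      ((hG k).le (Submodule.subset_span hx))
  refine ⟨S, hSU, le_antisymm ?_ ?_⟩
  · set T := Submodule.span ℂ
        {x : ℤ →₀ N | ∃ a b : ℕ, ∃ s ∈ S, x = ((Tsh N) ^ a) (((Zop z) ^ b) s)}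
    have hTsh : ∀ f ∈ T, Tsh N f ∈ T := by
      intro f hf
      induction hf using Submodule.span_induction with
      | mem x h =>
        obtain ⟨a, b, s, hs, rfl⟩ := h
        exact Submodule.subset_span ⟨a + 1, b, s, hs, by rw [pow_succ', LinearEquiv.mul_apply]⟩
      | zero => simp
      | add x y _ _ hx hy => rw [map_add]; exact add_mem hx hy
      | smul c x _ hx => rw [map_smul]; exact Submodule.smul_mem _ _ hx
    have hZ : ∀ f ∈ T, Zop z f ∈ T := by
      intro f hf
      induction hf using Submodule.span_induction with
      | mem x h =>
        obtain ⟨a, b, s, hs, rfl⟩ := h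
        exact Submodule.subset_span
          ⟨a, b + 1, s, hs, by rw [Zop_Tsh_pow, pow_succ', Module.End.mul_apply]⟩
      | zero => simp
      | add x y _ _ hx hy => rw [map_add]; exact add_mem hx hy
      | smul c x _ hx => rw [map_smul]; exact Submodule.smul_mem _ _ hx
    have hlow : ∀ k : ℤ, k ≤ n₁ → ∀ x ∈ V (β + k) ⊓ M, Finsupp.single k x ∈ T := by
      intro k hk x hx
      obtain hk0 | hk0 := le_total k n₀
      · rw [hn₀ k hk0, Submodule.mem_bot] at hx
        simp [hx]
      · rw [← hG k] at hx
        change x ∈ T.comap (Finsupp.lsingle k)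
        refine Submodule.span_le.2 (fun y hy => ?_) hx
        exact Submodule.subset_span ⟨0, 0, Finsupp.single k y, Finset.mem_biUnion.2
          ⟨k, Finset.mem_Icc.2 ⟨hk0, hk⟩, Finset.mem_image_of_mem _ hy⟩, by simp⟩
    have hhigh : ∀ k : ℤ, n₁ ≤ k → ∀ x ∈ V (β + k) ⊓ M, Finsupp.single k x ∈ T := by
      intro k hk
      induction k, hk using Int.leInduction with
      | base => exact hlow n₁ le_rfl
      | succ k hk ih =>
        intro x hx
        have hk' : (n₁ : ℝ) ≤ k := by exact_mod_cast hk
        rw [Int.cast_add, Int.cast_one, ← add_assoc] at hx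
        obtain ⟨y, hy, w, hw, rfl⟩ :=
          hV.exists_eq_add_z hM (hα₀ (β + k - 1) (by linarith)) hx
        rw [Finsupp.single_add, ← Tsh_single, ← Zop_single]
        exact add_mem (hTsh _ (ih y hy)) (hZ _ (ih w hw))
    intro f hf
    refine mem_of_single_mem _ _ fun k => ?_
    obtain hk | hk := le_total k n₁
    · exact hlow k hk _ (hf k)
    · exact hhigh k hk _ (hf k)
  · rw [Submodule.span_le]
    rintro _ ⟨a, b, s, hs, rfl⟩
    have hb : (Zop z ^ b) s ∈ tauU V M β := by
      induction b with
      | zero => simpa using hSU hs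
      | succ b ih =>
        rw [pow_succ', Module.End.mul_apply]
        exact hV.Zop_mem_tauU hM ih
    induction a with
    | zero => simpa using hb
    | succ a ih =>
      rw [pow_succ', LinearEquiv.mul_apply]
      exact hV.Tsh_mem_tauU ih

lemma tauU_eq_of_no_jump (hV : IsVLattice z V A) {β γ : ℝ} (hβγ : β ≤ γ)
    (h : ∀ a ∈ A, ∀ k : ℤ, ¬ (β < a + k ∧ a + k ≤ γ)) : tauU V M β = tauU V M γ := by
  unfold tauU
  congr 1
  ext1 k
  rw [hV.jumps (β + k) (γ + k) (by linarith)]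
  rintro a ha l ⟨h1, h2⟩
  refine h a ha (l - k) ⟨?_, ?_⟩ <;> push_cast <;> linarith

end IsVLattice

lemma Theta_add_smul_Zop_single (z : N ≃ₗ[ℂ] N) (nab : N →ₗ[ℂ] N) (β : ℝ) (k : ℤ) (x : N) :
    (Theta z nab + (β : ℂ) • Zop z) (Finsupp.single k x) =
      Finsupp.single (k + 1) (z ((nab + ((β + k : ℝ) : ℂ) • (LinearMap.id : N →ₗ[ℂ] N)) x)) := by
  rw [LinearMap.add_apply, LinearMap.smul_apply, Zop_single]
  simp only [Theta, Finsupp.lsum_single, LinearMap.comp_apply, Finsupp.lsingle_apply,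
    Finsupp.smul_single, ← Finsupp.single_add]
  congr 1
  simp only [LinearMap.add_apply, LinearMap.comp_apply, LinearMap.smul_apply, LinearMap.id_apply,
    LinearEquiv.coe_coe, map_add, map_smul, Complex.ofReal_add, Complex.ofReal_intCast, add_smul]
  abel

/-- The Leibniz rule for powers: `(∇ + c) z^n = z^n (∇ + c - n)`. -/
lemma nab_add_smul_pow {nab : N →ₗ[ℂ] N}
    (hLeib : ∀ x : N, nab (z x) = z (nab x) - z x) (c : ℂ) (n : ℕ) (x : N) :
    (nab + (c + n) • (LinearMap.id : N →ₗ[ℂ] N)) ((z ^ n) x) =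
      (z ^ n) ((nab + c • (LinearMap.id : N →ₗ[ℂ] N)) x) := by
  induction n with
  | zero => simp
  | succ n ih =>
    rw [pow_succ', LinearEquiv.mul_apply, LinearEquiv.mul_apply, ← ih]
    simp [hLeib, add_smul]
    abel

lemma Theta_add_smul_Zop_pow_single {nab : N →ₗ[ℂ] N}
    (hLeib : ∀ x : N, nab (z x) = z (nab x) - z x) (β : ℝ) (k : ℤ) (n : ℕ) (x : N) :
    ((Theta z nab + (β : ℂ) • Zop z) ^ n) (Finsupp.single k x) =
      Finsupp.single (k + n)
        ((z ^ n) (((nab + ((β + k : ℝ) : ℂ) • (LinearMap.id : N →ₗ[ℂ] N)) ^ n) x)) := by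
  induction n with
  | zero => simp
  | succ n ih =>
    rw [pow_succ', Module.End.mul_apply, ih, Theta_add_smul_Zop_single,
      show ((β + ((k + n : ℤ) : ℝ) : ℝ) : ℂ) = ((β + k : ℝ) : ℂ) + n by push_cast; ring,
      nab_add_smul_pow hLeib, pow_succ', pow_succ', LinearEquiv.mul_apply, Module.End.mul_apply]
    congr 1
    push_cast; ring

namespace IsVLattice

lemma Theta_pow_mem (hV : IsVLattice z V A) (hM : IsFreeLattice z M r) {nab : N →ₗ[ℂ] N}
    (hLeib : ∀ x : N, nab (z x) = z (nab x) - z x) (hMnab : ∀ m ∈ M, z (nab m) ∈ M)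
    {ν : ℕ} (hnil : ∀ β : ℝ, ∀ x ∈ V β,
      ((nab + (β : ℂ) • (LinearMap.id : N →ₗ[ℂ] N)) ^ ν) x ∈ Vlt V β)
    {β : ℝ} {f : ℤ →₀ N} (hf : f ∈ tauU V M β) :
    ((Theta z nab + (β : ℂ) • Zop z) ^ ν) f ∈ Vlt (tauU V M) β := by
  change f ∈ (Vlt (tauU V M) β).comap ((Theta z nab + (β : ℂ) • Zop z) ^ ν)
  refine mem_of_single_mem _ _ fun k => ?_
  have hM' (n : ℕ) : ((Theta z nab + (β : ℂ) • Zop z) ^ n) (Finsupp.single k (f k)) ∈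
      finsuppPi (fun _ : ℤ => M) := by
    induction n with
    | zero => exact single_mem_finsuppPi (W := fun _ : ℤ => M) (hf k).2
    | succ n ih =>
      rw [pow_succ', Module.End.mul_apply]
      rw [Theta_add_smul_Zop_pow_single hLeib] at ih ⊢
      have := ih (k + n)
      rw [Finsupp.single_eq_same] at this
      rw [Theta_add_smul_Zop_single]
      refine single_mem_finsuppPi (W := fun _ : ℤ => M) ?_
      rw [LinearMap.add_apply, LinearMap.smul_apply, LinearMap.id_apply, map_add, map_smul]
      exact add_mem (hMnab _ this) (Submodule.smul_mem _ _ (hM.1 _ this))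
  rw [Submodule.mem_comap, hV.mem_Vlt_tauU]
  refine fun l => ⟨?_, hM' ν l⟩
  rw [Theta_add_smul_Zop_pow_single hLeib]
  refine single_mem_finsuppPi (W := fun l : ℤ => Vlt V (β + l)) ?_ l
  have := (hV.pow_mem_Vlt_iff ν).2 (hnil _ _ (hf k).1)
  rwa [Int.cast_add, Int.cast_natCast, ← add_assoc]

/-- `τU_β / τU_{<β}` is torsion-free over `ℂ[z]`: compare components of lowest degree. -/
lemma mem_Vlt_tauU_of_aeval_mem (hV : IsVLattice z V A) {β : ℝ} {p : Polynomial ℂ} (hp : p ≠ 0)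
    {f : ℤ →₀ N} (hf : f ∈ tauU V M β)
    (hpf : (Polynomial.aeval (Zop z) p) f ∈ Vlt (tauU V M) β) : f ∈ Vlt (tauU V M) β := by
  rw [hV.mem_Vlt_tauU] at hpf ⊢
  suffices h : ∀ k : ℤ, f k ∈ Vlt V (β + k) from fun k => ⟨h k, (hf k).2⟩
  obtain ⟨n₀, hn₀⟩ := f.support.bddBelow
  have hlow : ∀ k : ℤ, k < n₀ → f k ∈ Vlt V (β + k) := by
    intro k hk
    rw [Finsupp.notMem_support_iff.1 fun h => absurd (hn₀ h) (not_le.2 hk)]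
    exact zero_mem _
  have hstrong (n : ℕ) : ∀ k : ℤ, k < n₀ + n → f k ∈ Vlt V (β + k) := by
    induction n with
    | zero => simpa using hlow
    | succ n ih =>
      intro k hk
      set j := p.natTrailingDegree with hj
      have h := (hpf (k + j)).1
      rw [Polynomial.aeval_eq_sum_range, LinearMap.sum_apply, Finsupp.finsetSum_apply,
        ← Finset.add_sum_erase _ _
          (Finset.mem_range.2 (Nat.lt_succ_of_le p.natTrailingDegree_le_natDegree))] at h
      have hrest : ∑ i ∈ (Finset.range (p.natDegree + 1)).erase j,
          (p.coeff i • Zop z ^ i) f (k + j) ∈ Vlt V (β + ((k + j : ℤ) : ℝ)) := by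
        refine Submodule.sum_mem _ fun i hi => ?_
        have hij : i ≠ j := Finset.ne_of_mem_erase hi
        rw [LinearMap.smul_apply, Finsupp.smul_apply, Zop_pow_apply]
        obtain hlt | hgt := lt_or_gt_of_ne hij
        · rw [Polynomial.coeff_eq_zero_of_lt_natTrailingDegree hlt, zero_smul]
          exact zero_mem _
        · refine Submodule.smul_mem _ _ ?_
          have := (hV.pow_mem_Vlt_iff i).2 (ih (k + j - i) (by lia))
          convert this using 2
          push_cast; ring
      have hlead := (Submodule.add_mem_iff_left _ hrest).1 h
      rw [LinearMap.smul_apply, Finsupp.smul_apply, Zop_pow_apply,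
        Submodule.smul_mem_iff _ (by simpa [hj] using hp), add_sub_cancel_right, Int.cast_add,
        Int.cast_natCast, ← add_assoc, hV.pow_mem_Vlt_iff] at hlead
      exact hlead
  intro k
  exact hstrong (k - n₀ + 1).toNat k (by lia)

end IsVLattice

end Helpers

/-- Core of the proof of Proposition 2.4.2: for a compatible connection `∇`, the family
`τU_β := ⊕_{k∈ℤ} τ^k ⊗ (V_{β+k} ∩ M)` is the V-filtration of the rescaled module `τM`
along `τ = 0`:
(a) it is increasing and exhausts `τM`, `τ·τU_β = τU_{β−1}`, and `z·τU_β ⊆ τU_β`;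
(b) each `τU_β` is finitely generated over `ℂ[τ,z]`;
(c) `τU_β = τU_γ` whenever `β ≤ γ` and `(β,γ]` contains no element of `A + ℤ`;
(d) `(Θ + β·z)^ν (τU_β) ⊆ τU_{<β}`;
(e) each `τU_β/τU_{<β}` is torsion-free over `ℂ[z]`. -/
theorem statement16 (z : N ≃ₗ[ℂ] N) (M : Submodule ℂ N) (r : ℕ)
    (V : ℝ → Submodule ℂ N) (A : Finset ℝ)
    (hM : IsFreeLattice z M r) (hV : IsVLattice z V A)
    (nab : N →ₗ[ℂ] N)
    -- the Leibniz rule `∇(f·n) = −z·(df/dz)·n + f·∇(n)` (on the generator `f = z`,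
    -- which determines it for all `f ∈ ℂ[z,z⁻¹]`):
    (hLeib : ∀ x : N, nab (z x) = z (nab x) - z x)
    -- `z·∇(M) ⊆ M`:
    (hMnab : ∀ m ∈ M, z (nab m) ∈ M)
    -- `∇(V_β) ⊆ V_β`:
    (hVnab : ∀ β : ℝ, ∀ x ∈ V β, nab x ∈ V β)
    (ν : ℕ)
    -- `(∇ + β·id)^ν (V_β) ⊆ V_{<β}`:
    (hnil : ∀ β : ℝ, ∀ x ∈ V β,
      ((nab + (β : ℂ) • (LinearMap.id : N →ₗ[ℂ] N)) ^ ν) x ∈ Vlt V β) :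
    -- (a)
    (Monotone (tauU V M) ∧
      (⨆ β : ℝ, tauU V M β) = finsuppPi (fun _ : ℤ => M) ∧
      (∀ β : ℝ, (tauU V M β).map (Tsh N).toLinearMap = tauU V M (β - 1)) ∧
      (∀ β : ℝ, ∀ f ∈ tauU V M β, Zop z f ∈ tauU V M β)) ∧
    -- (b)
    (∀ β : ℝ, ∃ S : Finset (ℤ →₀ N), (S : Set (ℤ →₀ N)) ⊆ tauU V M β ∧
      tauU V M β = Submodule.span ℂ
        {x : ℤ →₀ N | ∃ a b : ℕ, ∃ s ∈ S, x = ((Tsh N) ^ a) (((Zop z) ^ b) s)}) ∧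
    -- (c)
    (∀ β γ : ℝ, β ≤ γ →
      (∀ a ∈ A, ∀ k : ℤ, ¬ (β < a + k ∧ a + k ≤ γ)) → tauU V M β = tauU V M γ) ∧
    -- (d)
    (∀ β : ℝ, ∀ f ∈ tauU V M β,
      ((Theta z nab + (β : ℂ) • Zop z) ^ ν) f ∈ Vlt (tauU V M) β) ∧
    -- (e)
    (∀ β : ℝ, ∀ p : Polynomial ℂ, p ≠ 0 → ∀ f ∈ tauU V M β,
      (Polynomial.aeval (Zop z) p) f ∈ Vlt (tauU V M) β → f ∈ Vlt (tauU V M) β) := by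
  refine ⟨⟨hV.monotone_tauU, hV.iSup_tauU, fun β => ?_, fun β f => hV.Zop_mem_tauU hM⟩,
    hV.fg_tauU hM, fun β γ => hV.tauU_eq_of_no_jump,
    fun β f => hV.Theta_pow_mem hM hLeib hMnab hnil,
    fun β p hp f => hV.mem_Vlt_tauU_of_aeval_mem hp⟩
  ext f
  rw [Submodule.mem_map_equiv, ← IsVLattice.Tsh_mem_tauU_iff, LinearEquiv.apply_symm_apply]
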